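/- For k ≥ 0 define h_k := Σ_{(i,j) ∈ ℕ²: i+3j=k} (1/(i!·j!))·(−4/3)^j·X^i ∈ ℂ[X] (equivalently, Σ_k h_k λ^k = exp(Xλ − (4/3)λ³) as a formal power series in λ over ℂ[X]), and set h_k := 0 for k < 0. Let τ₀ := 1 and for m ≥ 1 let τ_m ∈ ℂ[X] be the determinant of the m × m matrix whose (i,j) entry (1 ≤ i, j ≤ m) is h_{m+j−2i+1}. Then τ_m ≠ 0 for every m ≥ 0, and for every m ≥ 1 the rational function w_m := τ_{m−1}′/τ_{m−1} − τ_m′/τ_m ∈ ℂ(X) satisfies the second Painlevé equation with parameter m: w_m″ = 2·w_m³ + X·w_m + m. -/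

import Mathlib

open Polynomial

/-- The complete homogeneous polynomials `h_k` for the second Painlevé
equation, defined by `Σ_k h_k λ^k = exp(Xλ − (4/3)λ³)`; `h_k = 0` for `k < 0`. -/
noncomputable def painleveH (k : ℤ) : Polynomial ℂ :=
  if k < 0 then 0
  else
    ∑ p ∈ (Finset.range (k.toNat + 1) ×ˢ Finset.range (k.toNat + 1)).filter
        (fun p => p.1 + 3 * p.2 = k.toNat),
      Polynomial.C
          ((1 / ((Nat.factorial p.1 : ℂ) * (Nat.factorial p.2 : ℂ))) *
            ((-4 : ℂ) / 3) ^ p.2) *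
        X ^ p.1

/-- The Jacobi–Trudi polynomial τ-function: the `m × m` determinant with
(1-based) `(i,j)` entry `h_{m+j−2i+1}`. -/
noncomputable def painleveTau (m : ℕ) : Polynomial ℂ :=
  Matrix.det (Matrix.of fun i j : Fin m =>
    painleveH ((m : ℤ) + ((j : ℕ) : ℤ) - 2 * ((i : ℕ) : ℤ)))

section GeneralDeterminants

open Matrix

variable {R : Type*} [CommRing R] {n : Type*} [Fintype n] [DecidableEq n]

/-- A three-term Plücker relation, in terms of Cramer's rule. -/
theorem Matrix.cramer_mul_cramer (A : Matrix n n R) (u v : n → R) {i j : n} (hij : i ≠ j) :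
    A.cramer v j * A.cramer u i =
      A.det * ((A.updateCol j v).updateCol i u).det + A.cramer v i * A.cramer u j := by
  set N := A.updateCol j v with hN
  set x := N.cramer u with hx
  have hxj : x j = A.cramer u j := by
    simp [hx, hN, cramer_apply]
  have hNx : N *ᵥ x = A *ᵥ x + x j • (v - A.col j) := by
    ext k
    have h : ∀ l, N k l * x l = A k l * x l + if l = j then x j * (v k - A k j) else 0 := by
      intro l
      rw [hN, updateCol_apply]
      split_ifs with h
      · subst h; ring
      · ring
    simp [mulVec, dotProduct, h, Finset.sum_add_distrib]
  have hcol : A.adjugate *ᵥ A.col j = A.det • Pi.single j 1 := by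
    rw [← mulVec_single_one, mulVec_mulVec, adjugate_mul, smul_mulVec, one_mulVec]
  have h := congrArg (fun y => (A.adjugate *ᵥ y) i) (mulVec_cramer N u)
  simp only [← hx] at h
  rw [hNx, mulVec_add, mulVec_smul, mulVec_sub, mulVec_mulVec, adjugate_mul, mulVec_smul, hcol,
    smul_mulVec, one_mulVec, ← cramer_eq_adjugate_mulVec, ← cramer_eq_adjugate_mulVec] at h
  simp only [Pi.add_apply, Pi.smul_apply, Pi.sub_apply, smul_eq_mul, Pi.single_apply, hij,
    if_false, hxj] at h
  have hNdet : N.det = A.cramer v j := by rw [cramer_apply]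
  have hxi : x i = (N.updateCol i u).det := by rw [hx, cramer_apply]
  rw [hNdet, hxi] at h
  linear_combination -h

/-- Replacing columns one at a time or rows one at a time gives the same total. -/
theorem Matrix.sum_det_updateCol_eq_sum_det_updateRow (A B : Matrix n n R) :
    ∑ j, (A.updateCol j fun i => B i j).det = ∑ i, (A.updateRow i (B i)).det := by
  simp only [← cramer_apply, ← cramer_transpose_apply, cramer_eq_adjugate_mulVec, mulVec,
    dotProduct, ← adjugate_transpose, transpose_apply]
  rw [Finset.sum_comm]

theorem Polynomial.derivative_det (A : Matrix n n R[X]) :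
    derivative A.det = ∑ j, (A.updateCol j fun i => derivative (A i j)).det := by
  simp only [det_apply, derivative_sum, Units.smul_def, zsmul_eq_mul]
  rw [Finset.sum_comm]
  refine Finset.sum_congr rfl fun σ _ => ?_
  rw [← Finset.mul_sum, ← zsmul_eq_mul, derivative_smul, derivative_prod_finset, zsmul_eq_mul]
  congr 1
  refine Finset.sum_congr rfl fun j _ => ?_
  rw [← Finset.prod_erase_mul _ _ (Finset.mem_univ j), updateCol_self]
  congr 1
  refine Finset.prod_congr rfl fun k hk => ?_
  rw [updateCol_ne (Finset.ne_of_mem_erase hk)]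

end GeneralDeterminants

/-- The coefficient polynomials `X ^ i / i!` of `exp (X λ)`, zero for negative `i`. -/
noncomputable def expCoeff (i : ℤ) : ℂ[X] :=
  if i < 0 then 0 else C (1 / (i.toNat.factorial : ℂ)) * X ^ i.toNat

/-- The coefficients `(-4/3) ^ j / j!` of `exp (-(4/3) λ)`. -/
noncomputable def cubicCoeff (j : ℕ) : ℂ[X] := C (1 / (j.factorial : ℂ) * (-4 / 3) ^ j)

theorem expCoeff_of_neg {i : ℤ} (hi : i < 0) : expCoeff i = 0 := by
  simp [expCoeff, hi]

theorem expCoeff_natCast (i : ℕ) : expCoeff i = C (1 / (i.factorial : ℂ)) * X ^ i := by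
  simp [expCoeff]

theorem intCast_mul_expCoeff (i : ℤ) : (i : ℂ[X]) * expCoeff i = X * expCoeff (i - 1) := by
  rcases lt_or_ge i 0 with hi | hi
  · rw [expCoeff_of_neg hi, expCoeff_of_neg (by lia)]; simp
  lift i to ℕ using hi
  cases i with
  | zero => rw [expCoeff_of_neg (i := _ - 1) (by simp)]; simp
  | succ i =>
    rw [show ((i + 1 : ℕ) : ℤ) - 1 = (i : ℕ) by push_cast; ring, expCoeff_natCast,
      expCoeff_natCast]
    have h : (((i + 1 : ℕ) : ℤ) : ℂ[X]) = C ((i : ℂ) + 1) := by simp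
    have h' : ((i : ℂ) + 1) * (1 / ((i + 1).factorial : ℂ)) = 1 / (i.factorial : ℂ) := by
      have := Nat.cast_add_one_ne_zero (R := ℂ) i
      rw [Nat.factorial_succ]; push_cast; field_simp
    rw [h, ← mul_assoc, ← C_mul, h']
    ring

theorem derivative_expCoeff (i : ℤ) : derivative (expCoeff i) = expCoeff (i - 1) := by
  rcases lt_or_ge i 0 with hi | hi
  · rw [expCoeff_of_neg hi, expCoeff_of_neg (by lia)]; simp
  lift i to ℕ using hi
  cases i with
  | zero => rw [expCoeff_of_neg (i := _ - 1) (by simp), expCoeff_natCast]; simp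
  | succ i =>
    rw [show ((i + 1 : ℕ) : ℤ) - 1 = (i : ℕ) by push_cast; ring, expCoeff_natCast,
      expCoeff_natCast]
    have h' : (1 / ((i + 1).factorial : ℂ)) * ((i : ℂ) + 1) = 1 / (i.factorial : ℂ) := by
      have := Nat.cast_add_one_ne_zero (R := ℂ) i
      rw [Nat.factorial_succ]; push_cast; field_simp
    rw [derivative_C_mul_X_pow, ← h']
    simp

theorem natCast_succ_mul_cubicCoeff (j : ℕ) :
    3 * ((j : ℂ[X]) + 1) * cubicCoeff (j + 1) = -4 * cubicCoeff j := by
  have h : 3 * ((j : ℂ) + 1) * (1 / ((j + 1).factorial : ℂ) * (-4 / 3) ^ (j + 1)) =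
      -4 * (1 / (j.factorial : ℂ) * (-4 / 3) ^ j) := by
    have := Nat.cast_add_one_ne_zero (R := ℂ) j
    rw [Nat.factorial_succ]; push_cast; field_simp; ring
  have h3 : (C 3 : ℂ[X]) = 3 := rfl
  have h4 : (C 4 : ℂ[X]) = 4 := rfl
  simpa [cubicCoeff, -one_div, h3, h4] using congrArg (C : ℂ → ℂ[X]) h

theorem painleveH_of_neg {k : ℤ} (hk : k < 0) : painleveH k = 0 := by
  simp [painleveH, hk]

theorem painleveH_eq_sum {k : ℤ} {N : ℕ} (hN : k < 3 * N) :
    painleveH k = ∑ j ∈ Finset.range N, cubicCoeff j * expCoeff (k - 3 * j) := by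
  rcases lt_or_ge k 0 with hk | hk
  · rw [painleveH_of_neg hk]
    refine (Finset.sum_eq_zero fun j _ => ?_).symm
    rw [expCoeff_of_neg (by lia), mul_zero]
  lift k to ℕ using hk
  have hext : ∀ N : ℕ, (k : ℤ) < 3 * N →
      ∑ j ∈ Finset.range N, cubicCoeff j * expCoeff (k - 3 * j) =
        ∑ j ∈ Finset.range (max N (k + 1)), cubicCoeff j * expCoeff (k - 3 * j) := by
    intro N hN
    refine Finset.sum_subset (by simp) fun j _ hj => ?_
    rw [Finset.mem_range] at hj
    rw [expCoeff_of_neg (by lia), mul_zero]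
  have hmax : ∑ j ∈ Finset.range N, cubicCoeff j * expCoeff ((k : ℤ) - 3 * j) =
      ∑ j ∈ Finset.range (k + 1), cubicCoeff j * expCoeff ((k : ℤ) - 3 * j) := by
    rw [hext N hN]
    symm
    refine Finset.sum_subset (by simp) fun j _ hj => ?_
    rw [Finset.mem_range] at hj
    rw [expCoeff_of_neg (by lia), mul_zero]
  rw [hmax, painleveH, if_neg (by lia), Finset.sum_filter, Finset.sum_product_right,
    Int.toNat_natCast]
  refine Finset.sum_congr rfl fun j _ => ?_
  by_cases hj : 3 * j ≤ k
  · rw [Finset.sum_eq_single (k - 3 * j)]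
    · rw [if_pos (by dsimp only; lia), show (k : ℤ) - 3 * j = ((k - 3 * j : ℕ) : ℤ) by lia,
        expCoeff_natCast, cubicCoeff, ← mul_assoc, ← C_mul]
      congr 2
      rw [one_div, mul_inv]
      ring
    · intro i _ hi
      rw [if_neg (by dsimp only; lia)]
    · intro h
      exact absurd (Finset.mem_range.2 (by lia)) h
  · rw [expCoeff_of_neg (by lia), mul_zero]
    refine Finset.sum_eq_zero fun i _ => if_neg (by dsimp only; lia)

theorem painleveH_zero : painleveH 0 = 1 := by
  rw [painleveH_eq_sum (N := 1) (by simp)]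
  simp [cubicCoeff, expCoeff]

theorem derivative_painleveH (k : ℤ) : derivative (painleveH k) = painleveH (k - 1) := by
  have h : k < 3 * (k.toNat + 1 : ℕ) := by lia
  rw [painleveH_eq_sum h, painleveH_eq_sum (k := k - 1) (N := k.toNat + 1) (by lia),
    derivative_sum]
  refine Finset.sum_congr rfl fun j _ => ?_
  rw [cubicCoeff, derivative_C_mul, derivative_expCoeff, sub_right_comm]

/-- Euler's relation, expressing the weighted homogeneity of `painleveH k`. -/
theorem intCast_mul_painleveH (k : ℤ) :
    (k : ℂ[X]) * painleveH k = X * painleveH (k - 1) - 4 * painleveH (k - 3) := by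
  have h : k < 3 * (k.toNat + 1 : ℕ) := by lia
  have hterm : ∀ j : ℕ, (k : ℂ[X]) * (cubicCoeff j * expCoeff (k - 3 * j)) =
      X * (cubicCoeff j * expCoeff (k - 1 - 3 * j)) +
        3 * (j : ℂ[X]) * cubicCoeff j * expCoeff (k - 3 * j) := by
    intro j
    have := intCast_mul_expCoeff (k - 3 * j)
    rw [sub_right_comm] at this
    push_cast at this
    linear_combination cubicCoeff j * this
  rw [painleveH_eq_sum h, painleveH_eq_sum (k := k - 1) (N := k.toNat + 1) (by lia),
    painleveH_eq_sum (k := k - 3) (N := k.toNat) (by lia), Finset.mul_sum, Finset.mul_sum,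
    Finset.sum_congr rfl fun j _ => hterm j, Finset.sum_add_distrib,
    sub_eq_add_neg (Finset.sum _ _), Finset.sum_range_succ' (fun j : ℕ => 3 * (j : ℂ[X]) * cubicCoeff j * expCoeff (k - 3 * j)),
    Finset.mul_sum, ← Finset.sum_neg_distrib]
  congr 1
  simp only [Nat.cast_zero, mul_zero, zero_mul, add_zero]
  refine Finset.sum_congr rfl fun j _ => ?_
  rw [show k - 3 * ((j + 1 : ℕ) : ℤ) = k - 3 - 3 * j by push_cast; ring]
  have := natCast_succ_mul_cubicCoeff j
  push_cast
  linear_combination expCoeff (k - 3 - 3 * j) * this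

/-- The determinant of the matrix whose `j`-th column is `(h_{c j}, h_{c j - 2}, h_{c j - 4}, …)`. -/
noncomputable def jacobiTrudi {k : ℕ} (c : Fin k → ℤ) : ℂ[X] :=
  Matrix.det (Matrix.of fun i j : Fin k => painleveH (c j - 2 * ((i : ℕ) : ℤ)))

namespace jacobiTrudi

open Matrix Function

variable {k : ℕ}

theorem eq_zero_of_eq (c : Fin k → ℤ) {i j : Fin k} (hij : i ≠ j) (h : c i = c j) :
    jacobiTrudi c = 0 :=
  det_zero_of_column_eq hij fun l => by simp [h]

theorem updateCol_eq (c : Fin k → ℤ) (j : Fin k) (x : ℤ) :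
    ((of fun i j : Fin k => painleveH (c j - 2 * ((i : ℕ) : ℤ))).updateCol j
      fun i => painleveH (x - 2 * ((i : ℕ) : ℤ))).det = jacobiTrudi (update c j x) := by
  rw [jacobiTrudi]
  congr 1
  ext i l
  rw [updateCol_apply, of_apply, of_apply, update_apply]
  split_ifs <;> rfl

theorem comp_perm (c : Fin k → ℤ) (σ : Equiv.Perm (Fin k)) :
    jacobiTrudi (c ∘ σ) = ((Equiv.Perm.sign σ : ℤ) : ℂ[X]) * jacobiTrudi c := by
  rw [jacobiTrudi, jacobiTrudi, ← det_permute']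
  rfl

theorem eq_neg_of_swap {c d : Fin k → ℤ} {i j : Fin k} (hij : i ≠ j) (hi : c i = d j)
    (hj : c j = d i) (h : ∀ l, l ≠ i → l ≠ j → c l = d l) : jacobiTrudi c = -jacobiTrudi d := by
  have hc : c = d ∘ Equiv.swap i j := by
    ext l
    rw [Function.comp_apply, Equiv.swap_apply_def]
    split_ifs with h₁ h₂
    · rw [h₁, hi]
    · rw [h₂, hj]
    · exact h l h₁ h₂
  rw [hc, comp_perm, Equiv.Perm.sign_swap hij]
  simp

theorem snoc_eq_cons (c : Fin k → ℤ) (x : ℤ) :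
    jacobiTrudi (Fin.snoc c x : Fin (k + 1) → ℤ) =
      (-1) ^ k * jacobiTrudi (Fin.cons x c : Fin (k + 1) → ℤ) := by
  have h := comp_perm (Fin.cons x c : Fin (k + 1) → ℤ) (finRotate (k + 1))
  rw [sign_finRotate] at h
  have h' : (Fin.snoc c x : Fin (k + 1) → ℤ) = Fin.cons x c ∘ finRotate (k + 1) :=
    Fin.snoc_eq_cons_rotate c x
  rw [h', h]
  simp

theorem cons_zero (c : Fin k → ℤ) :
    jacobiTrudi (Fin.cons 0 c : Fin (k + 1) → ℤ) = jacobiTrudi fun j => c j - 2 := by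
  rw [jacobiTrudi, det_succ_column_zero, Finset.sum_eq_single 0]
  · simp only [of_apply, Fin.cons_zero, Fin.val_zero, pow_zero, Nat.cast_zero, mul_zero, sub_zero,
      painleveH_zero, one_mul, jacobiTrudi]
    congr 1
    ext i j : 2
    simp only [submatrix_apply, of_apply, Fin.succAbove_zero, Fin.cons_succ, Fin.val_succ]
    congr 1
    push_cast
    ring_nf
  · intro i _ hi
    have : 0 < (i : ℕ) := Fin.pos_iff_ne_zero.2 hi
    rw [of_apply, Fin.cons_zero, painleveH_of_neg (by lia)]
    simp
  · simp

theorem snoc_two_mul (c : Fin k → ℤ) (hc : ∀ j, c j < 2 * k) :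
    jacobiTrudi (Fin.snoc c (2 * k) : Fin (k + 1) → ℤ) = jacobiTrudi c := by
  rw [jacobiTrudi, det_succ_row _ (Fin.last k), Finset.sum_eq_single (Fin.last k)]
  · simp only [of_apply, Fin.snoc_last, Fin.val_last, sub_self, painleveH_zero, mul_one,
      jacobiTrudi, Even.neg_one_pow ⟨k, rfl⟩, one_mul]
    congr 1
    ext i j : 2
    simp only [submatrix_apply, of_apply, Fin.succAbove_last, Fin.snoc_castSucc, Fin.val_castSucc]
  · intro j _ hj
    obtain ⟨j, rfl⟩ := Fin.exists_castSucc_eq.2 hj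
    have := hc j
    rw [of_apply, Fin.snoc_castSucc, painleveH_of_neg (by simp; lia)]
    ring
  · simp

/-- The sum over all columns of the determinants in which the index of one column is lowered. -/
noncomputable def shiftSum (a : ℤ) (c : Fin k → ℤ) : ℂ[X] :=
  ∑ j, jacobiTrudi (update c j (c j - a))

theorem derivative_eq (c : Fin k → ℤ) : derivative (jacobiTrudi c) = shiftSum 1 c := by
  rw [jacobiTrudi, derivative_det, shiftSum]
  refine Finset.sum_congr rfl fun j _ => ?_
  rw [← updateCol_eq]
  simp only [of_apply, derivative_painleveH, sub_right_comm]

theorem shiftSum_two (c : Fin k → ℤ) (hc : ∀ j, c j < 2 * k) : shiftSum 2 c = 0 := by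
  simp only [shiftSum, ← updateCol_eq]
  refine (sum_det_updateCol_eq_sum_det_updateRow _
    (of fun i j : Fin k => painleveH (c j - 2 - 2 * ((i : ℕ) : ℤ)))).trans ?_
  refine Finset.sum_eq_zero fun i _ => ?_
  by_cases hi : (i : ℕ) + 1 < k
  · have hne : i ≠ ⟨i + 1, hi⟩ := fun h => by simpa using congrArg Fin.val h
    refine det_zero_of_row_eq hne ?_
    rw [updateRow_self, updateRow_ne hne.symm]
    ext1 j
    simp only [of_apply]
    congr 1
    push_cast
    ring
  · refine det_eq_zero_of_row_eq_zero i fun j => ?_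
    have := hc j
    rw [updateRow_self, of_apply, painleveH_of_neg (by lia)]

theorem euler (c : Fin k → ℤ) :
    ((∑ j, (c j - 2 * ((j : ℕ) : ℤ)) : ℤ) : ℂ[X]) * jacobiTrudi c =
      X * shiftSum 1 c - 4 * shiftSum 3 c := by
  set A : Matrix (Fin k) (Fin k) ℂ[X] :=
    of fun i j : Fin k => painleveH (c j - 2 * ((i : ℕ) : ℤ)) with hA
  have hrow := sum_det_updateCol_eq_sum_det_updateRow A
    (of fun i j : Fin k => (((i : ℕ) : ℤ) : ℂ[X]) * A i j)
  have hrow' : ∀ i : Fin k, (A.updateRow i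
      ((of fun i j : Fin k => (((i : ℕ) : ℤ) : ℂ[X]) * A i j) i)).det =
        (((i : ℕ) : ℤ) : ℂ[X]) * A.det := by
    intro i
    have : (of fun i j : Fin k => (((i : ℕ) : ℤ) : ℂ[X]) * A i j) i =
      (((i : ℕ) : ℤ) : ℂ[X]) • A i := rfl
    rw [this, det_updateRow_smul, updateRow_eq_self]
  let v : Fin k → Fin k → ℂ[X] := fun j i => (((i : ℕ) : ℤ) : ℂ[X]) * A i j
  have hcol : ∀ j : Fin k, X * jacobiTrudi (update c j (c j - 1)) -
      4 * jacobiTrudi (update c j (c j - 3)) =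
        (c j : ℂ[X]) * A.det - 2 * (A.updateCol j (v j)).det := by
    intro j
    have hself : A.det = A.cramer (A.col j) j := by
      rw [cramer_apply]
      exact congrArg det (updateCol_eq_self A j).symm
    have hvec : (X : ℂ[X]) • (fun i : Fin k => painleveH (c j - 1 - 2 * ((i : ℕ) : ℤ))) -
        (4 : ℂ[X]) • (fun i : Fin k => painleveH (c j - 3 - 2 * ((i : ℕ) : ℤ))) =
        (c j : ℂ[X]) • A.col j - (2 : ℂ[X]) • v j := by
      ext1 i
      have := intCast_mul_painleveH (c j - 2 * ((i : ℕ) : ℤ))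
      simp only [Pi.sub_apply, Pi.smul_apply, smul_eq_mul, col_apply, v, hA, of_apply]
      rw [sub_right_comm _ 1, sub_right_comm _ 3, ← this]
      push_cast
      ring
    have h := congrArg (fun y => A.cramer y j) hvec
    simp only [map_sub, map_smul, Pi.sub_apply, Pi.smul_apply, smul_eq_mul, ← hself] at h
    simpa only [cramer_apply, hA, updateCol_eq] using h
  simp only [hrow'] at hrow
  have hrow'' : ∑ j, (A.updateCol j (v j)).det =
      ∑ i : Fin k, (((i : ℕ) : ℤ) : ℂ[X]) * A.det := hrow
  have hsum : X * shiftSum 1 c - 4 * shiftSum 3 c =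
      ∑ j, (c j : ℂ[X]) * A.det - 2 * ∑ j, (A.updateCol j (v j)).det := by
    rw [shiftSum, shiftSum, Finset.mul_sum, Finset.mul_sum, Finset.mul_sum,
      ← Finset.sum_sub_distrib, ← Finset.sum_sub_distrib]
    exact Finset.sum_congr rfl fun j _ => hcol j
  rw [hsum, hrow'', ← Finset.sum_mul, ← Finset.sum_mul, show jacobiTrudi c = A.det from rfl]
  push_cast
  rw [Finset.sum_sub_distrib, ← Finset.mul_sum]
  ring

theorem pluecker (F : Fin k → ℤ) (u v x y : ℤ) :
    jacobiTrudi (Fin.cons x (Fin.snoc F v : Fin (k + 1) → ℤ) : Fin (k + 2) → ℤ) *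
        jacobiTrudi (Fin.cons u (Fin.snoc F y : Fin (k + 1) → ℤ) : Fin (k + 2) → ℤ) =
      jacobiTrudi (Fin.cons x (Fin.snoc F y : Fin (k + 1) → ℤ) : Fin (k + 2) → ℤ) *
          jacobiTrudi (Fin.cons u (Fin.snoc F v : Fin (k + 1) → ℤ) : Fin (k + 2) → ℤ) +
        jacobiTrudi (Fin.cons v (Fin.snoc F y : Fin (k + 1) → ℤ) : Fin (k + 2) → ℤ) *
          jacobiTrudi (Fin.cons x (Fin.snoc F u : Fin (k + 1) → ℤ) : Fin (k + 2) → ℤ) := by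
  set c : Fin (k + 2) → ℤ := Fin.cons x (Fin.snoc F y : Fin (k + 1) → ℤ) with hc
  have hlast : ∀ z, update c (Fin.last (k + 1)) z =
      (Fin.cons x (Fin.snoc F z : Fin (k + 1) → ℤ) : Fin (k + 2) → ℤ) := by
    intro z
    rw [hc, ← Fin.succ_last, ← Fin.cons_update, Fin.update_snoc_last]
  have h := cramer_mul_cramer (of fun i j : Fin (k + 2) => painleveH (c j - 2 * ((i : ℕ) : ℤ)))
    (fun i => painleveH (u - 2 * ((i : ℕ) : ℤ))) (fun i => painleveH (v - 2 * ((i : ℕ) : ℤ)))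
    (i := 0) (j := Fin.last (k + 1)) (Fin.last_pos.ne)
  have hupd : (of fun i j : Fin (k + 2) => painleveH (c j - 2 * ((i : ℕ) : ℤ))).updateCol
      (Fin.last (k + 1)) (fun i => painleveH (v - 2 * ((i : ℕ) : ℤ))) =
      of fun i j : Fin (k + 2) =>
        painleveH (update c (Fin.last (k + 1)) v j - 2 * ((i : ℕ) : ℤ)) := by
    ext i l
    rw [updateCol_apply, of_apply, of_apply, update_apply]
    split_ifs <;> rfl
  rw [hupd] at h
  simp only [cramer_apply, updateCol_eq, hlast] at h
  simp only [hc, Fin.update_cons_zero] at h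
  exact h

end jacobiTrudi

/-- The determinant `painleveTau (l + 1)` with its first column replaced by the one of index `x`. -/
noncomputable def shiftedTau (l : ℕ) (x : ℤ) : ℂ[X] :=
  jacobiTrudi (Fin.cons x (fun j : Fin l => (l : ℤ) + 2 + ((j : ℕ) : ℤ)) : Fin (l + 1) → ℤ)

theorem painleveTau_eq_jacobiTrudi (m : ℕ) :
    painleveTau m = jacobiTrudi fun j : Fin m => (m : ℤ) + ((j : ℕ) : ℤ) := rfl

theorem painleveTau_succ (l : ℕ) : painleveTau (l + 1) = shiftedTau l (l + 1) := by
  rw [painleveTau_eq_jacobiTrudi, shiftedTau]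
  congr 1
  ext j
  cases j using Fin.cases with
  | zero => simp
  | succ j => simp; ring

theorem painleveTau_mul_shiftedTau (l : ℕ) (x : ℤ) (hx : x ≤ l + 2) :
    painleveTau (l + 1) * shiftedTau (l + 2) x =
      painleveTau (l + 3) * shiftedTau l (x - 2) +
        painleveTau (l + 2) * shiftedTau (l + 1) x := by
  set F : Fin (l + 1) → ℤ := fun j => (l : ℤ) + 4 + ((j : ℕ) : ℤ) with hF
  set G : Fin l → ℤ := fun j => (l : ℤ) + 2 + ((j : ℕ) : ℤ) with hG
  have hsnoc : ∀ z : ℤ, jacobiTrudi (Fin.cons z (Fin.snoc F 0 : Fin (l + 2) → ℤ) : Fin (l + 3) → ℤ)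
      = (-1) ^ (l + 2) * jacobiTrudi fun j => (Fin.cons z F : Fin (l + 2) → ℤ) j - 2 := by
    intro z
    rw [Fin.cons_snoc_eq_snoc_cons, jacobiTrudi.snoc_eq_cons, jacobiTrudi.cons_zero]
  have hminor : ∀ z : ℤ, z ≤ l + 3 →
      (jacobiTrudi fun j => (Fin.cons z F : Fin (l + 2) → ℤ) j - 2) = shiftedTau l (z - 2) := by
    intro z hz
    have h : (fun j => (Fin.cons z F : Fin (l + 2) → ℤ) j - 2) =
        Fin.snoc (Fin.cons (z - 2) G : Fin (l + 1) → ℤ) (2 * ((l + 1 : ℕ) : ℤ)) := by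
      rw [← Fin.cons_snoc_eq_snoc_cons]
      ext j
      cases j using Fin.cases with
      | zero => simp
      | succ j =>
        cases j using Fin.lastCases with
        | last => simp [hF]; ring
        | cast j => simp [hF, hG]; ring
    rw [h, jacobiTrudi.snoc_two_mul]
    · rfl
    · intro j
      cases j using Fin.cases with
      | zero => simp; lia
      | succ j => have := j.isLt; simp [hG]; lia
  have hzero : jacobiTrudi (Fin.cons 0 (Fin.snoc F (2 * l + 5) : Fin (l + 2) → ℤ) :
      Fin (l + 3) → ℤ) = painleveTau (l + 2) := by
    rw [jacobiTrudi.cons_zero, painleveTau_eq_jacobiTrudi]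
    congr 1
    ext j
    cases j using Fin.lastCases with
    | last => simp; ring
    | cast j => simp [hF]; ring
  have hcons : ∀ z : ℤ, jacobiTrudi (Fin.cons z (Fin.snoc F (2 * l + 5) : Fin (l + 2) → ℤ) :
      Fin (l + 3) → ℤ) = shiftedTau (l + 2) z := by
    intro z
    rw [shiftedTau]
    congr 2
    ext j
    cases j using Fin.lastCases with
    | last => simp; ring
    | cast j => simp [hF]; ring
  have hrot : jacobiTrudi (Fin.cons ((l : ℤ) + 3) (Fin.snoc F x : Fin (l + 2) → ℤ) :
      Fin (l + 3) → ℤ) = (-1) ^ (l + 2) * shiftedTau (l + 1) x := by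
    rw [Fin.cons_snoc_eq_snoc_cons, jacobiTrudi.snoc_eq_cons]
    congr 1
    have h : (Fin.cons x (Fin.cons ((l : ℤ) + 3) F : Fin (l + 2) → ℤ) : Fin (l + 3) → ℤ) =
        Fin.snoc (Fin.cons x (fun j : Fin (l + 1) => ((l + 1 : ℕ) : ℤ) + 2 + ((j : ℕ) : ℤ)) :
          Fin (l + 2) → ℤ) (2 * ((l + 2 : ℕ) : ℤ)) := by
      rw [← Fin.cons_snoc_eq_snoc_cons]
      congr 1
      ext j
      cases j using Fin.cases with
      | zero => rw [← Fin.castSucc_zero, Fin.snoc_castSucc]; simp; ring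
      | succ j =>
        cases j using Fin.lastCases with
        | last => rw [Fin.succ_last, Fin.snoc_last]; simp [hF]; ring
        | cast j => rw [← Fin.castSucc_succ, Fin.snoc_castSucc]; simp [hF]; ring
    rw [h, jacobiTrudi.snoc_two_mul]
    · rfl
    · intro j
      cases j using Fin.cases with
      | zero => simp; lia
      | succ j => have := j.isLt; simp; lia
  have hp : painleveTau (l + 1) = shiftedTau l ((l : ℤ) + 3 - 2) := by
    rw [painleveTau_succ]; congr 1; lia
  have hr : painleveTau (l + 3) = shiftedTau (l + 2) ((l : ℤ) + 3) := by
    rw [painleveTau_succ]; congr 1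
  have h := jacobiTrudi.pluecker F x 0 ((l : ℤ) + 3) (2 * l + 5)
  rw [hsnoc, hsnoc, hminor _ le_rfl, hminor _ (by lia), hzero, hcons, hcons, hrot, ← hp, ← hr] at h
  have hsign : ((-1 : ℂ[X]) ^ (l + 2)) * (-1) ^ (l + 2) = 1 := by
    rw [← mul_pow]; simp
  linear_combination (-1) ^ (l + 2) * h - (painleveTau (l + 1) * shiftedTau (l + 2) x -
    painleveTau (l + 3) * shiftedTau l (x - 2) -
        painleveTau (l + 2) * shiftedTau (l + 1) x) * hsign

theorem painleveH_one : painleveH 1 = X := by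
  have h := intCast_mul_painleveH 1
  rw [painleveH_of_neg (k := 1 - 3) (by simp), sub_self, painleveH_zero] at h
  simpa using h

theorem three_mul_painleveH_two_mul_sub :
    3 * (painleveH 2 * painleveH 1 - painleveH 3) = X ^ 3 + 4 := by
  have h2 := intCast_mul_painleveH 2
  have h3 := intCast_mul_painleveH 3
  rw [painleveH_of_neg (k := 2 - 3) (by simp), show (2 : ℤ) - 1 = 1 by rfl, painleveH_one] at h2
  rw [sub_self, painleveH_zero, show (3 : ℤ) - 1 = 2 by rfl] at h3
  rw [painleveH_one]
  push_cast at h2 h3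
  linear_combination X * h2 - h3

theorem painleveTau_zero : painleveTau 0 = 1 := by
  simp [painleveTau]

theorem painleveTau_one : painleveTau 1 = X := by
  simp [painleveTau, painleveH_one]

theorem three_mul_painleveTau_two : 3 * painleveTau 2 = X ^ 3 + 4 := by
  rw [← three_mul_painleveH_two_mul_sub, painleveTau, Matrix.det_fin_two]
  simp [painleveH_zero, painleveH_one]

theorem shiftedTau_zero (x : ℤ) : shiftedTau 0 x = painleveH x := by
  simp [shiftedTau, jacobiTrudi]

theorem shiftedTau_one (x : ℤ) :
    shiftedTau 1 x = painleveH x * X - painleveH 3 * painleveH (x - 2) := by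
  rw [shiftedTau, jacobiTrudi, Matrix.det_fin_two]
  simp [painleveH_one]

theorem two_mul_sum_sub (a : ℤ) (m : ℕ) :
    2 * ∑ j : Fin m, (a + ((j : ℕ) : ℤ) - 2 * ((j : ℕ) : ℤ)) = 2 * a * m - m * (m - 1) := by
  induction m with
  | zero => simp
  | succ m ih =>
    rw [Fin.sum_univ_castSucc, mul_add]
    simp only [Fin.val_castSucc, Fin.val_last, ih]
    push_cast
    ring

/-- Euler's relation for the weighted homogeneous polynomial `painleveTau m`. -/
theorem painleveTau_euler (m : ℕ) :
    (m : ℂ[X]) * ((m : ℂ[X]) + 1) * painleveTau m = 2 * X * derivative (painleveTau m) -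
      8 * jacobiTrudi.shiftSum 3 (fun j : Fin m => (m : ℤ) + ((j : ℕ) : ℤ)) := by
  have h := jacobiTrudi.euler fun j : Fin m => (m : ℤ) + ((j : ℕ) : ℤ)
  have hs := congrArg (Int.cast : ℤ → ℂ[X]) (two_mul_sum_sub m m)
  rw [← jacobiTrudi.derivative_eq, ← painleveTau_eq_jacobiTrudi] at h
  push_cast at h hs
  linear_combination 2 * h - painleveTau m * hs

/-- The determinant `painleveTau (k + 3)` with its first three columns replaced by those of
index `x`, `y` and `z`. -/
noncomputable def tripleShiftedTau (k : ℕ) (x y z : ℤ) : ℂ[X] :=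
  jacobiTrudi (Fin.cons x (Fin.cons y (Fin.cons z
    (fun j : Fin k => (k : ℤ) + 6 + ((j : ℕ) : ℤ)) : Fin (k + 1) → ℤ) : Fin (k + 2) → ℤ) :
      Fin (k + 3) → ℤ)

namespace tripleShiftedTau

variable (k : ℕ) (x y z : ℤ)

theorem eq_self_left : tripleShiftedTau k x x z = 0 :=
  jacobiTrudi.eq_zero_of_eq _ (i := 0) (j := 1) (by simp) rfl

theorem eq_self_right : tripleShiftedTau k x y y = 0 :=
  jacobiTrudi.eq_zero_of_eq _ (i := Fin.succ 0) (j := Fin.succ (Fin.succ 0))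
    (fun h => Fin.succ_ne_zero _ (Fin.succ_injective _ h).symm) rfl

theorem swap_left : tripleShiftedTau k x y z = -tripleShiftedTau k y x z := by
  refine jacobiTrudi.eq_neg_of_swap (i := 0) (j := Fin.succ 0) (Fin.succ_ne_zero _).symm
    rfl rfl fun l hi hj => ?_
  cases l using Fin.cases with
  | zero => exact absurd rfl hi
  | succ l =>
    cases l using Fin.cases with
    | zero => exact absurd rfl hj
    | succ l => rfl

theorem swap_right : tripleShiftedTau k x y z = -tripleShiftedTau k x z y := by
  refine jacobiTrudi.eq_neg_of_swap (i := Fin.succ 0) (j := Fin.succ (Fin.succ 0))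
    (fun h => Fin.succ_ne_zero _ (Fin.succ_injective _ h).symm) rfl rfl fun l hi hj => ?_
  cases l using Fin.cases with
  | zero => rfl
  | succ l =>
    cases l using Fin.cases with
    | zero => exact absurd rfl hi
    | succ l =>
      cases l using Fin.cases with
      | zero => exact absurd rfl hj
      | succ l => rfl

variable {k x y z}

theorem shiftSum_eq {a : ℕ} (ha : 1 ≤ a)
    (h : ∀ i : ℤ, k + 6 - a ≤ i → i < k + 6 → i = x ∨ i = y ∨ i = z) :
    jacobiTrudi.shiftSum a (Fin.cons x (Fin.cons y (Fin.cons z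
      (fun j : Fin k => (k : ℤ) + 6 + ((j : ℕ) : ℤ)) : Fin (k + 1) → ℤ) : Fin (k + 2) → ℤ) :
        Fin (k + 3) → ℤ) =
      tripleShiftedTau k (x - a) y z + tripleShiftedTau k x (y - a) z +
        tripleShiftedTau k x y (z - a) := by
  rw [jacobiTrudi.shiftSum, Fin.sum_univ_succ, Fin.sum_univ_succ, Fin.sum_univ_succ]
  simp only [← Fin.cons_update, Fin.update_cons_zero, Fin.cons_zero, Fin.cons_succ]
  rw [Finset.sum_eq_zero (s := (Finset.univ : Finset (Fin k))), add_zero, ← add_assoc]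
  · rfl
  · intro j _
    by_cases hj : (a : ℤ) ≤ (j : ℕ)
    · have hlt : (j : ℕ) - a < k := (Nat.sub_le _ _).trans_lt j.isLt
      refine jacobiTrudi.eq_zero_of_eq _ (i := j.succ.succ.succ)
        (j := (⟨(j : ℕ) - a, hlt⟩ : Fin k).succ.succ.succ) ?_ ?_
      · simp [Fin.ext_iff]; lia
      · simp only [Fin.cons_succ, Function.update_self]
        rw [Function.update_of_ne (by simp [Fin.ext_iff]; lia)]
        simp; lia
    · rcases h (k + 6 + (j : ℕ) - a) (by lia) (by lia) with h | h | h
      · refine jacobiTrudi.eq_zero_of_eq _ (i := j.succ.succ.succ) (j := 0)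
          (Fin.succ_ne_zero _) ?_
        simp only [Fin.cons_succ, Function.update_self]
        exact h
      · have hne : j.succ.succ.succ ≠ Fin.succ 0 :=
          fun h => Fin.succ_ne_zero _ (Fin.succ_injective _ h)
        refine jacobiTrudi.eq_zero_of_eq _ hne ?_
        simp only [Fin.cons_succ, Function.update_self]
        exact h
      · have hne : j.succ.succ.succ ≠ Fin.succ (Fin.succ 0) :=
          fun h => Fin.succ_ne_zero _ (Fin.succ_injective _ (Fin.succ_injective _ h))
        refine jacobiTrudi.eq_zero_of_eq _ hne ?_
        simp only [Fin.cons_succ, Function.update_self]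
        exact h

theorem derivative_eq (h : k + 5 = x ∨ k + 5 = y ∨ k + 5 = z) :
    derivative (tripleShiftedTau k x y z) =
      tripleShiftedTau k (x - 1) y z + tripleShiftedTau k x (y - 1) z +
        tripleShiftedTau k x y (z - 1) := by
  rw [tripleShiftedTau, jacobiTrudi.derivative_eq]
  exact shiftSum_eq (a := 1) le_rfl fun i h₁ h₂ => by
    obtain rfl : i = k + 5 := by push_cast at h₁; lia
    exact h

theorem shiftSum_two_eq (h : ∀ i : ℤ, k + 4 ≤ i → i < k + 6 → i = x ∨ i = y ∨ i = z)
    (hx : x < 2 * (k + 3)) (hy : y < 2 * (k + 3)) (hz : z < 2 * (k + 3)) :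
    tripleShiftedTau k (x - 2) y z + tripleShiftedTau k x (y - 2) z +
      tripleShiftedTau k x y (z - 2) = 0 := by
  refine (shiftSum_eq (a := 2) (by simp) fun i h₁ h₂ => h i ?_ h₂).symm.trans
    (jacobiTrudi.shiftSum_two _ fun j => ?_)
  · push_cast at h₁; lia
  · cases j using Fin.cases with
    | zero => change x < _; push_cast; lia
    | succ j =>
      cases j using Fin.cases with
      | zero => change y < _; push_cast; lia
      | succ j =>
        cases j using Fin.cases with
        | zero => change z < _; push_cast; lia
        | succ j => have := j.isLt; simp; lia

end tripleShiftedTau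

theorem shiftedTau_eq_tripleShiftedTau (k : ℕ) (x : ℤ) :
    shiftedTau (k + 2) x = tripleShiftedTau k x (k + 4) (k + 5) := by
  rw [shiftedTau, tripleShiftedTau]
  congr 2
  ext j
  cases j using Fin.cases with
  | zero => simp; ring
  | succ j =>
    cases j using Fin.cases with
    | zero => simp; ring
    | succ j => simp; ring

theorem painleveTau_eq_tripleShiftedTau (k : ℕ) :
    painleveTau (k + 3) = tripleShiftedTau k (k + 3) (k + 4) (k + 5) := by
  rw [← shiftedTau_eq_tripleShiftedTau, painleveTau_succ]
  congr 1

theorem shiftSum_three_eq_tripleShiftedTau (k : ℕ) :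
    jacobiTrudi.shiftSum 3 (fun j : Fin (k + 3) => ((k + 3 : ℕ) : ℤ) + ((j : ℕ) : ℤ)) =
      tripleShiftedTau k k (k + 4) (k + 5) + tripleShiftedTau k (k + 3) (k + 1) (k + 5) +
        tripleShiftedTau k (k + 3) (k + 4) (k + 2) := by
  have hc : (fun j : Fin (k + 3) => ((k + 3 : ℕ) : ℤ) + ((j : ℕ) : ℤ)) =
      Fin.cons ((k : ℤ) + 3) (Fin.cons ((k : ℤ) + 4) (Fin.cons ((k : ℤ) + 5)
        (fun j : Fin k => (k : ℤ) + 6 + ((j : ℕ) : ℤ)) : Fin (k + 1) → ℤ) : Fin (k + 2) → ℤ) := by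
    ext j
    cases j using Fin.cases with
    | zero => simp
    | succ j =>
      cases j using Fin.cases with
      | zero => simp; ring
      | succ j =>
        cases j using Fin.cases with
        | zero => simp only [Fin.cons_succ, Fin.cons_zero, Fin.val_succ, Fin.val_zero]; simp; ring
        | succ j => simp; ring
  have h := tripleShiftedTau.shiftSum_eq (k := k) (x := k + 3) (y := k + 4) (z := k + 5)
    (a := 3) (by simp) (fun i h₁ h₂ => by push_cast at h₁; lia)
  rw [hc]
  refine h.trans ?_
  push_cast
  congr 3 <;> ring

theorem derivative_painleveTau_add_three (k : ℕ) :
    derivative (painleveTau (k + 3)) = tripleShiftedTau k (k + 2) (k + 4) (k + 5) := by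
  rw [painleveTau_eq_tripleShiftedTau, tripleShiftedTau.derivative_eq (by simp),
    show (k : ℤ) + 3 - 1 = k + 2 by ring, show (k : ℤ) + 4 - 1 = k + 3 by ring,
    show (k : ℤ) + 5 - 1 = k + 4 by ring, tripleShiftedTau.eq_self_left,
    tripleShiftedTau.eq_self_right, add_zero, add_zero]

theorem derivative_derivative_painleveTau_add_three (k : ℕ) :
    derivative (derivative (painleveTau (k + 3))) =
      2 * tripleShiftedTau k (k + 1) (k + 4) (k + 5) := by
  have h := tripleShiftedTau.shiftSum_two_eq (k := k) (x := k + 3) (y := k + 4) (z := k + 5)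
    (fun i h₁ h₂ => by lia)
  rw [derivative_painleveTau_add_three, tripleShiftedTau.derivative_eq (by simp),
    show (k : ℤ) + 2 - 1 = k + 1 by ring, show (k : ℤ) + 4 - 1 = k + 3 by ring,
    show (k : ℤ) + 5 - 1 = k + 4 by ring, tripleShiftedTau.eq_self_right]
  rw [show (k : ℤ) + 3 - 2 = k + 1 by ring, show (k : ℤ) + 4 - 2 = k + 2 by ring,
    show (k : ℤ) + 5 - 2 = k + 3 by ring, tripleShiftedTau.swap_left k (k + 3) (k + 2),
    tripleShiftedTau.swap_right k (k + 3) (k + 4) (k + 3), tripleShiftedTau.eq_self_left] at h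
  linear_combination -h (by lia) (by lia) (by lia)

theorem derivative_derivative_derivative_painleveTau_add_three (k : ℕ) :
    derivative (derivative (derivative (painleveTau (k + 3)))) =
      2 * (tripleShiftedTau k k (k + 4) (k + 5) + tripleShiftedTau k (k + 1) (k + 3) (k + 5)) := by
  rw [derivative_derivative_painleveTau_add_three, derivative_mul, derivative_ofNat,
    tripleShiftedTau.derivative_eq (by simp),
    show (k : ℤ) + 1 - 1 = k by ring, show (k : ℤ) + 4 - 1 = k + 3 by ring,
    show (k : ℤ) + 5 - 1 = k + 4 by ring, tripleShiftedTau.eq_self_right]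
  ring

theorem derivative_painleveTau_two : derivative (painleveTau 2) = X ^ 2 := by
  have h := congrArg derivative three_mul_painleveTau_two
  rw [derivative_mul, derivative_ofNat, derivative_add, derivative_X_pow, derivative_ofNat,
    map_natCast] at h
  have h3 : (3 : ℂ[X]) ≠ 0 := by norm_num
  refine mul_left_cancel₀ h3 ?_
  simpa using h

theorem derivative_derivative_painleveTau_two :
    derivative (derivative (painleveTau 2)) = 2 * X := by
  rw [derivative_painleveTau_two, derivative_X_pow, map_natCast]
  simp

theorem derivative_derivative_derivative_painleveTau_two :
    derivative (derivative (derivative (painleveTau 2))) = 2 := by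
  rw [derivative_derivative_painleveTau_two]
  simp

theorem shiftedTau_natCast (l : ℕ) : shiftedTau l l = derivative (painleveTau (l + 1)) := by
  match l with
  | 0 => simp [shiftedTau_zero, painleveTau_one, painleveH_zero]
  | 1 =>
    rw [shiftedTau_one, painleveH_of_neg (k := (1 : ℕ) - 2) (by simp), Nat.cast_one,
      painleveH_one, derivative_painleveTau_two]
    ring
  | k + 2 =>
    rw [derivative_painleveTau_add_three, shiftedTau_eq_tripleShiftedTau]
    congr 1

theorem two_mul_shiftedTau_sub_one (l : ℕ) :
    2 * shiftedTau l (l - 1) = derivative (derivative (painleveTau (l + 1))) := by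
  match l with
  | 0 => simp [shiftedTau_zero, painleveTau_one, painleveH_of_neg]
  | 1 =>
    rw [shiftedTau_one, Nat.cast_one, sub_self, painleveH_zero,
      painleveH_of_neg (k := 0 - 2) (by simp), derivative_derivative_painleveTau_two]
    ring
  | k + 2 =>
    rw [derivative_derivative_painleveTau_add_three, ← shiftedTau_eq_tripleShiftedTau]
    congr 2
    push_cast
    ring

theorem shiftedTau_sub_two (l : ℕ) :
    24 * shiftedTau l (l - 2) =
      4 * derivative (derivative (derivative (painleveTau (l + 1)))) +
        2 * X * derivative (painleveTau (l + 1)) -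
          ((l : ℂ[X]) + 1) * ((l : ℂ[X]) + 2) * painleveTau (l + 1) := by
  match l with
  | 0 =>
    simp [shiftedTau_zero, painleveTau_one, painleveH_of_neg]
  | 1 =>
    rw [shiftedTau_one, Nat.cast_one, painleveH_of_neg (k := 1 - 2 - 2) (by simp),
      painleveH_of_neg (k := 1 - 2) (by simp), derivative_derivative_derivative_painleveTau_two,
      derivative_painleveTau_two]
    push_cast
    linear_combination 2 * three_mul_painleveTau_two
  | k + 2 =>
    have h := tripleShiftedTau.shiftSum_two_eq (k := k) (x := k + 2) (y := k + 4) (z := k + 5)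
      (fun i h₁ h₂ => by lia) (by lia) (by lia) (by lia)
    have he := painleveTau_euler (k + 3)
    have h3 := derivative_derivative_derivative_painleveTau_add_three k
    rw [show (k : ℤ) + 2 - 2 = k by ring, show (k : ℤ) + 4 - 2 = k + 2 by ring,
      show (k : ℤ) + 5 - 2 = k + 3 by ring, tripleShiftedTau.eq_self_left,
      tripleShiftedTau.swap_left k (k + 2) (k + 4), tripleShiftedTau.swap_right k (k + 4) (k + 2),
      tripleShiftedTau.swap_left k (k + 4) (k + 3)] at h
    rw [shiftSum_three_eq_tripleShiftedTau, tripleShiftedTau.swap_left k (k + 3) (k + 1)] at he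
    rw [show ((k + 2 : ℕ) : ℤ) - 2 = k by simp, shiftedTau_eq_tripleShiftedTau]
    push_cast at he ⊢
    rw [show k + 2 + 1 = k + 3 from rfl]
    linear_combination he + 8 * h - 4 * h3

theorem painleveTau_wronskian (l : ℕ) :
    painleveTau l * derivative (painleveTau (l + 2)) -
      derivative (painleveTau l) * painleveTau (l + 2) = painleveTau (l + 1) ^ 2 := by
  cases l with
  | zero =>
    rw [painleveTau_zero, painleveTau_one, derivative_painleveTau_two, derivative_one]
    ring
  | succ l =>
    have h := painleveTau_mul_shiftedTau l (l + 2) le_rfl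
    rw [show (l : ℤ) + 2 - 2 = l by ring, shiftedTau_natCast,
      show (l : ℤ) + 2 = ((l + 2 : ℕ) : ℤ) by simp, shiftedTau_natCast,
      show ((l + 2 : ℕ) : ℤ) = ((l + 1 : ℕ) : ℤ) + 1 by push_cast; ring, ← painleveTau_succ] at h
    linear_combination h

theorem painleveTau_third_order (l : ℕ) :
    2 * (painleveTau l * derivative (derivative (derivative (painleveTau (l + 2)))) -
      derivative (derivative (derivative (painleveTau l))) * painleveTau (l + 2)) +
        X * painleveTau (l + 1) ^ 2 - (2 * (l : ℂ[X]) + 3) * painleveTau l * painleveTau (l + 2) =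
      6 * painleveTau (l + 1) * derivative (derivative (painleveTau (l + 1))) := by
  cases l with
  | zero =>
    rw [painleveTau_zero, painleveTau_one, derivative_derivative_derivative_painleveTau_two]
    simp
    linear_combination -three_mul_painleveTau_two
  | succ l =>
    have h := painleveTau_mul_shiftedTau l l (by lia)
    have hp := shiftedTau_sub_two l
    have hr := shiftedTau_sub_two (l + 2)
    have hq := two_mul_shiftedTau_sub_one (l + 1)
    have hw := painleveTau_wronskian (l + 1)
    rw [show ((l + 2 : ℕ) : ℤ) - 2 = l by simp] at hr
    rw [show ((l + 1 : ℕ) : ℤ) - 1 = l by simp] at hq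
    push_cast at hr ⊢
    have h2 : (2 : ℂ[X]) ≠ 0 := by norm_num
    refine mul_left_cancel₀ h2 ?_
    rw [show l + 1 + 2 = l + 3 from rfl, show l + 1 + 1 = l + 2 from rfl] at *
    rw [show l + 2 + 1 = l + 3 from rfl] at *
    linear_combination 24 * h - painleveTau (l + 1) * hr + painleveTau (l + 3) * hp +
      12 * painleveTau (l + 2) * hq - 2 * X * hw

section

variable {R : Type*} [CommRing R] [IsDomain R]
  {p₀ p₁ p₂ p₃ q₀ q₁ q₂ q₃ r₀ r₁ r₂ r₃ x m : R}

theorem hirota_second_step (hp : p₀ ≠ 0)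
    (hA : p₂ * q₀ - 2 * p₁ * q₁ + p₀ * q₂ = 0)
    (hW : p₀ * r₁ - p₁ * r₀ = q₀ ^ 2)
    (hW₁ : p₀ * r₂ - p₂ * r₀ = 2 * q₀ * q₁) :
    q₂ * r₀ - 2 * q₁ * r₁ + q₀ * r₂ = 0 := by
  refine mul_left_cancel₀ hp ?_
  linear_combination r₀ * hA - 2 * q₁ * hW + q₀ * hW₁

theorem hirota_third_step (hp : p₀ ≠ 0) (hq : q₀ ≠ 0)
    (hA : p₂ * q₀ - 2 * p₁ * q₁ + p₀ * q₂ = 0)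
    (hB : p₃ * q₀ - 3 * p₂ * q₁ + 3 * p₁ * q₂ - p₀ * q₃ - x * (p₁ * q₀ - p₀ * q₁) -
      m * p₀ * q₀ = 0)
    (hW : p₀ * r₁ - p₁ * r₀ = q₀ ^ 2)
    (hW₁ : p₀ * r₂ - p₂ * r₀ = 2 * q₀ * q₁)
    (hW₂ : p₀ * r₃ + p₁ * r₂ - p₂ * r₁ - p₃ * r₀ = 2 * q₀ * q₂ + 2 * q₁ ^ 2)
    (hE : 2 * (p₀ * r₃ - p₃ * r₀) + x * q₀ ^ 2 - (2 * m + 1) * p₀ * r₀ = 6 * q₀ * q₂) :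
    q₃ * r₀ - 3 * q₂ * r₁ + 3 * q₁ * r₂ - q₀ * r₃ - x * (q₁ * r₀ - q₀ * r₁) -
      (m + 1) * q₀ * r₀ = 0 := by
  have hV : p₁ * r₂ - p₂ * r₁ = q₀ * q₂ := by
    refine mul_left_cancel₀ hq ?_
    linear_combination p₁ * hirota_second_step hp hA hW hW₁ - r₁ * hA + q₂ * hW
  refine mul_left_cancel₀ hp ?_
  linear_combination -r₀ * hB + (x * q₀ - 3 * q₂) * hW + 3 * q₁ * hW₁ - 3 * q₀ * (hW₂ - hV) +
    q₀ * hE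

end

/-- Consecutive τ-functions are nonzero and satisfy the Hirota bilinear equations of the second
Painlevé equation. -/
theorem painleveTau_hirota (l : ℕ) :
    painleveTau l ≠ 0 ∧ painleveTau (l + 1) ≠ 0 ∧
    derivative (derivative (painleveTau l)) * painleveTau (l + 1) -
      2 * derivative (painleveTau l) * derivative (painleveTau (l + 1)) +
        painleveTau l * derivative (derivative (painleveTau (l + 1))) = 0 ∧
    derivative (derivative (derivative (painleveTau l))) * painleveTau (l + 1) -
      3 * derivative (derivative (painleveTau l)) * derivative (painleveTau (l + 1)) +
        3 * derivative (painleveTau l) * derivative (derivative (painleveTau (l + 1))) -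
          painleveTau l * derivative (derivative (derivative (painleveTau (l + 1)))) -
            X * (derivative (painleveTau l) * painleveTau (l + 1) -
              painleveTau l * derivative (painleveTau (l + 1))) -
                ((l : ℂ[X]) + 1) * painleveTau l * painleveTau (l + 1) = 0 := by
  induction l with
  | zero => simp [painleveTau_zero, painleveTau_one]
  | succ l ih =>
    obtain ⟨hp, hq, hA, hB⟩ := ih
    have hW := painleveTau_wronskian l
    have hW₁ := congrArg derivative hW
    simp only [derivative_sub, derivative_mul, derivative_sq] at hW₁
    have hW₂ := congrArg derivative hW₁
    simp only [derivative_sub, derivative_add, derivative_mul, derivative_C, zero_mul,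
      zero_add] at hW₂
    have hE := painleveTau_third_order l
    rw [show l + 1 + 1 = l + 2 from rfl]
    have hW₁' : painleveTau l * derivative (derivative (painleveTau (l + 2))) -
        derivative (derivative (painleveTau l)) * painleveTau (l + 2) =
          2 * painleveTau (l + 1) * derivative (painleveTau (l + 1)) := by
      rw [map_ofNat] at hW₁
      linear_combination hW₁
    refine ⟨hq, ?_, hirota_second_step hp hA hW hW₁', ?_⟩
    · intro h
      simp only [h, derivative_zero, mul_zero, sub_zero] at hW
      exact pow_ne_zero 2 hq hW.symm
    · push_cast
      refine hirota_third_step hp hq hA hB hW hW₁' ?_ ?_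
      · rw [map_ofNat] at hW₂
        linear_combination hW₂
      · linear_combination hE

section

variable {F : Type*} [Field F] {D : F → F}

theorem map_div_of_leibniz (hmul : ∀ x y, D (x * y) = x * D y + D x * y) (a : F) {b : F}
    (hb : b ≠ 0) : D (a / b) = D a / b - a / b * (D b / b) := by
  have h := hmul (a / b) b
  rw [div_mul_cancel₀ a hb] at h
  rw [h]
  field_simp
  ring

theorem map_sub_of_additive (hadd : ∀ x y, D (x + y) = D x + D y) (x y : F) :
    D (x - y) = D x - D y := by
  have h := hadd (x - y) y
  rw [sub_add_cancel] at h
  rw [h, add_sub_cancel_right]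

/-- The second Painlevé equation follows from the Hirota bilinear equations. -/
theorem painleveII_of_hirota (hadd : ∀ x y, D (x + y) = D x + D y)
    (hmul : ∀ x y, D (x * y) = x * D y + D x * y) {p q x m : F} (hp : p ≠ 0) (hq : q ≠ 0)
    (hA : D (D p) * q - 2 * D p * D q + p * D (D q) = 0)
    (hB : D (D (D p)) * q - 3 * D (D p) * D q + 3 * D p * D (D q) - p * D (D (D q)) -
      x * (D p * q - p * D q) - m * p * q = 0) :
    D (D (D p / p - D q / q)) =
      2 * (D p / p - D q / q) ^ 3 + x * (D p / p - D q / q) + m := by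
  have hsub := map_sub_of_additive hadd
  have hA' : D (D p) / p - 2 * (D p / p) * (D q / q) + D (D q) / q = 0 := by
    field_simp
    linear_combination hA
  have hB' : D (D (D p)) / p - 3 * (D (D p) / p) * (D q / q) + 3 * (D p / p) * (D (D q) / q) -
      D (D (D q)) / q - x * (D p / p - D q / q) - m = 0 := by
    field_simp
    linear_combination hB
  simp only [hsub, hmul, map_div_of_leibniz hmul _ hp, map_div_of_leibniz hmul _ hq]
  linear_combination hB' - 3 * (D p / p - D q / q) * hA'

end

/-- The polynomial τ-functions are nonzero and produce rational solutions of
the second Painlevé equation with parameter `m`. -/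
theorem PII_rational_solutions_from_tau
    (D : RatFunc ℂ → RatFunc ℂ)
    (hD_add : ∀ x y : RatFunc ℂ, D (x + y) = D x + D y)
    (hD_mul : ∀ x y : RatFunc ℂ, D (x * y) = x * D y + D x * y)
    (hD_poly : ∀ p : Polynomial ℂ,
      D (algebraMap (Polynomial ℂ) (RatFunc ℂ) p) =
        algebraMap (Polynomial ℂ) (RatFunc ℂ) (derivative p)) :
    (∀ m : ℕ, painleveTau m ≠ 0) ∧
    ∀ m : ℕ, 1 ≤ m →
      let w : RatFunc ℂ :=
        algebraMap (Polynomial ℂ) (RatFunc ℂ) (derivative (painleveTau (m - 1))) /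
            algebraMap (Polynomial ℂ) (RatFunc ℂ) (painleveTau (m - 1)) -
          algebraMap (Polynomial ℂ) (RatFunc ℂ) (derivative (painleveTau m)) /
            algebraMap (Polynomial ℂ) (RatFunc ℂ) (painleveTau m)
      D (D w) = 2 * w ^ 3 + RatFunc.X * w + (m : RatFunc ℂ) := by
  refine ⟨fun m => (painleveTau_hirota m).1, fun m hm => ?_⟩
  obtain ⟨l, rfl⟩ := Nat.exists_eq_add_of_le' hm
  obtain ⟨hp, hq, hA, hB⟩ := painleveTau_hirota l
  have hA' := congrArg (algebraMap ℂ[X] (RatFunc ℂ)) hA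
  have hB' := congrArg (algebraMap ℂ[X] (RatFunc ℂ)) hB
  simp only [map_add, map_sub, map_mul, map_natCast, map_ofNat, map_one, map_zero,
    ← hD_poly, RatFunc.algebraMap_X] at hA' hB'
  rw [Nat.add_sub_cancel, ← hD_poly, ← hD_poly, Nat.cast_add, Nat.cast_one]
  exact painleveII_of_hirota hD_add hD_mul (RatFunc.algebraMap_ne_zero hp)
    (RatFunc.algebraMap_ne_zero hq) hA' hB'
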